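/- For $M\in\mathbb N$ put $Q_M(u)=\prod_{k=1}^M(1-u^k)\in\mathbb Q[[u]]$ and $Q_\infty(u)=\prod_{k\ge1}(1-u^k)\in\mathbb Q[[u]]$. Work in the field $\mathbb Q((A))$ of formal Laurent series, with $q=A^{-4}$ and $u=q^{-1}=A^4$, and put $\{n\}=A^{2n}-A^{-2n}$, $\{n\}!=\prod_{k=1}^n\{k\}$, $[n]=\{n\}/\{1\}$, $[n]!=\prod_{k=1}^n[k]$, $\Delta_n=(-1)^n[n+1]$, $$\theta(a,b,c)=(-1)^{i+j+k}\frac{[i+j+k+1]!\,[i]!\,[j]!\,[k]!}{[i+j]!\,[j+k]!\,[i+k]!},\quad i=\tfrac{b+c-a}2,\ j=\tfrac{a+c-b}2,\ k=\tfrac{a+b-c}2,$$ $$\gamma(a,b,c)=(-1)^{\frac{a+b-c}2}A^{a+b-c+\frac{a^2+b^2-c^2}2}.$$ For $0\le j_1,j_2,j_3\le N$ let $\Gamma_{N,(j_1,j_2,j_3)}$ be the Kauffman bracket evaluation of the triangular prism graph whose two triangles have all edges coloured $N$ and whose three joining edges are coloured $2j_1,2j_2,2j_3$; explicitly $\Gamma_{N,(j_1,j_2,j_3)}=T^2/\theta(2j_1,2j_2,2j_3)$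 (read as $0$ if $(2j_1,2j_2,2j_3)$ is not admissible, i.e. if some $j_i$ exceeds the sum of the other two), where, with $(a_1,\dots,a_4)=(N+j_1,N+j_2,N+j_3,j_1+j_2+j_3)$ and $(b_1,b_2,b_3)=(N+j_2+j_3,N+j_1+j_3,N+j_1+j_2)$, $$T=\frac{\prod_{i,k}[b_k-a_i]!}{[N]!^3\,[2j_1]!\,[2j_2]!\,[2j_3]!}\sum_{\max a_i\le s\le\min b_k}\frac{(-1)^s[s+1]!}{\prod_i[s-a_i]!\,\prod_k[b_k-s]!}$$ is the tetrahedron coefficient. For integers $m_1,m_2,m_3\ge0$ (the numbers of crossings in the three negative twist regions of a pretzel knot) let $$\overline{S_{j_1,j_2,j_3}}=\frac{(-1)^N\{1\}}{\{N+1\}}\;\Gamma_{N,(j_1,j_2,j_3)}\prod_{i=1}^3\gamma(N,N,2j_i)^{m_i}\frac{\Delta_{2j_i}}{\theta(N,N,2j_i)}.$$ Let $N\ge5$ be an integer. Then: (1) In $\mathbb Q[[u]]$, $$\frac{Q_{3N-2}(u)\,(1-u^{2N-5})\,Q_{N+3}(u)\,Q_N(u)^2}{(1-u^{N+1})\,Q_{2N}(u)^2\,Q_{2N-2}(u)\,(1-u)(1-u^2)(1-u^3)}\equiv\frac{Q_N(u)}{(1-u)(1-u^2)(1-u^3)}\pmod{u^N}.$$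 (2) For all integers $m_1,m_2,m_3\ge0$, up to a sign and multiplication by an integer power of $A$, $$\overline{S_{N-3,N,N}}\ \text{ equals }\ \frac{\{3N-2\}!\,\{2N-5\}\,\{N+3\}!\,\{N\}!^2}{\{N+1\}\,\{2N\}!^2\,\{2N-2\}!\,\{3\}!}.$$ (3) For all integers $m_1,m_2,m_3\ge0$, the coefficients of the $N$ terms of highest degree in $q$ of $\overline{S_{N-3,N,N}}$ agree, up to a common sign, with those of $$\frac{-Q_\infty(q^{-1})}{(1-q^{-3})(1-q^{-2})(1-q^{-1})}.$$ Here the terms are counted from the leading one in steps of one in the degree in $q$, zero coefficients included, and all coefficients at the intermediate degrees (in $\tfrac14\mathbb Z$, relative to the leading one) in this range agree in the same sense. -/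

import Mathlib

namespace Pretzel

open PowerSeries

/-- `Q M = ∏_{k=1}^M (1 - u^k)` in `ℚ⟦u⟧`. -/
noncomputable def Q (M : ℕ) : PowerSeries ℚ :=
  ∏ k ∈ Finset.Icc 1 M, (1 - (X : PowerSeries ℚ) ^ k)

/-- The infinite product `∏_{k ≥ 1} (1 - u^k)` in `ℚ⟦u⟧`, as the coefficientwise limit of the
partial products `Q M`: see `coeff_Q_eq`. -/
noncomputable def Qinf : PowerSeries ℚ :=
  PowerSeries.mk fun n => coeff n (Q n)

/-- The `n`-th coefficient of the partial products is constant from `M = n` on. -/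
theorem coeff_Q_eq (n M : ℕ) (h : n ≤ M) : coeff n (Q M) = coeff n Qinf := by
  induction M, h using Nat.le_induction with
  | base => simp [Qinf]
  | succ M hM ih =>
    have hQ : Q (M + 1) = Q M - Q M * X ^ (M + 1) := by
      rw [Q, Finset.prod_Icc_succ_top (by omega), ← Q, mul_sub, mul_one]
    rw [hQ, map_sub, coeff_mul_X_pow', if_neg (by omega), sub_zero, ih]

/-- The variable `A` of the Kauffman bracket. All skein quantities live in the field `ℚ((A))`
of Laurent series in `A`. Since `q = A⁻⁴`, the terms of highest degree in `q` are those of lowest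
degree in `A`, and rational functions are expanded in powers of `q⁻¹ = A⁴`. -/
noncomputable def A : LaurentSeries ℚ := HahnSeries.single (1 : ℤ) (1 : ℚ)

/-- The embedding `ℚ⟦u⟧ → ℚ((A))` with `u = q⁻¹ = A⁴`. -/
noncomputable def inA (f : PowerSeries ℚ) : LaurentSeries ℚ :=
  HahnSeries.ofPowerSeries ℤ ℚ (PowerSeries.expand 4 (by norm_num) f)

/-- `{n} = A^{2n} - A^{-2n}`. -/
noncomputable def curly (n : ℕ) : LaurentSeries ℚ := A ^ (2 * (n : ℤ)) - A ^ (-(2 * (n : ℤ)))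

/-- `{n}! = {n}{n-1}⋯{1}`. -/
noncomputable def curlyFact (n : ℕ) : LaurentSeries ℚ := ∏ k ∈ Finset.Icc 1 n, curly k

/-- `[n] = {n}/{1}`. -/
noncomputable def bracket (n : ℕ) : LaurentSeries ℚ := curly n / curly 1

/-- `[n]! = [n][n-1]⋯[1]`. -/
noncomputable def bracketFact (n : ℕ) : LaurentSeries ℚ := ∏ k ∈ Finset.Icc 1 n, bracket k

/-- The loop value `Δ_n = (-1)^n [n+1]`. -/
noncomputable def Delta (n : ℕ) : LaurentSeries ℚ := (-1) ^ n * bracket (n + 1)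

/-- The trihedron coefficient in its internal colours,
`(-1)^{i+j+k} [i+j+k+1]! [i]! [j]! [k]! / ([i+j]! [j+k]! [i+k]!)`. -/
noncomputable def thetaInt (i j k : ℕ) : LaurentSeries ℚ :=
  (-1) ^ (i + j + k) *
    (bracketFact (i + j + k + 1) * bracketFact i * bracketFact j * bracketFact k) /
    (bracketFact (i + j) * bracketFact (j + k) * bracketFact (i + k))

/-- The trihedron coefficient `θ(a,b,c)` of an admissible triple: `a + b + c` is even and each of
`a, b, c` is at most the sum of the other two. -/
noncomputable def theta (a b c : ℕ) : LaurentSeries ℚ :=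
  thetaInt ((b + c - a) / 2) ((a + c - b) / 2) ((a + b - c) / 2)

/-- The negative half-twist coefficient
`γ(a,b,c) = (-1)^{(a+b-c)/2} A^{a+b-c+(a²+b²-c²)/2}` (for `a + b - c` even and nonnegative). -/
noncomputable def gamma (a b c : ℕ) : LaurentSeries ℚ :=
  (-1) ^ ((a + b - c) / 2) *
    A ^ ((a : ℤ) + b - c + ((a : ℤ) ^ 2 + (b : ℤ) ^ 2 - (c : ℤ) ^ 2) / 2)

/-- The tetrahedral network with a triangle of edges coloured `N, N, N` whose corners are joined to
a fourth vertex by edges coloured `2j₁, 2j₂, 2j₃`, in the closed form of Kauffman and Lins: the `a`s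
are the half-sums of the colours at the four vertices, the `b`s those around the three
quadrilaterals. The sum is empty, hence the value `0`, if `(2j₁, 2j₂, 2j₃)` is not admissible. -/
noncomputable def tet (N j₁ j₂ j₃ : ℕ) : LaurentSeries ℚ :=
  let a : Fin 4 → ℕ := ![N + j₁, N + j₂, N + j₃, j₁ + j₂ + j₃]
  let b : Fin 3 → ℕ := ![N + j₂ + j₃, N + j₁ + j₃, N + j₁ + j₂]
  (∏ i, ∏ k, bracketFact (b k - a i)) /
      (bracketFact N ^ 3 *
        (bracketFact (2 * j₁) * bracketFact (2 * j₂) * bracketFact (2 * j₃))) *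
    ∑ s ∈ Finset.Icc (max (max (a 0) (a 1)) (max (a 2) (a 3))) (min (min (b 0) (b 1)) (b 2)),
      (-1) ^ s * bracketFact (s + 1) /
        ((∏ i, bracketFact (s - a i)) * ∏ k, bracketFact (b k - s))

/-- `Γ_{N,(j₁,j₂,j₃)}`: the evaluation of the trivalent graph that is left of the `N`-cabled
three-strand pretzel diagram after fusing the two strands of each twist region and removing the
half-twists. It is the triangular prism with both triangles coloured `N, N, N` and the three
joining edges coloured `2j₁, 2j₂, 2j₃`; replacing each triangle by a vertex gives `tet² / θ`. -/
noncomputable def Gam (N j₁ j₂ j₃ : ℕ) : LaurentSeries ℚ :=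
  tet N j₁ j₂ j₃ ^ 2 / theta (2 * j₁) (2 * j₂) (2 * j₃)

/-- The contribution `γ(N,N,2j)^m Δ_{2j} / θ(N,N,2j)` of one twist region with `m` crossings. -/
noncomputable def twistFactor (N m j : ℕ) : LaurentSeries ℚ :=
  gamma N N (2 * j) ^ m * (Delta (2 * j) / theta N N (2 * j))

/-- The summand `S_{j₁,j₂,j₃}`, `0 ≤ jᵢ ≤ N`, of the coloured Jones polynomial `J_{N+1,K}` of the
pretzel knot `K` with three negative twist regions with `m₁, m₂, m₃` crossings. -/
noncomputable def summand (N m₁ m₂ m₃ j₁ j₂ j₃ : ℕ) : LaurentSeries ℚ :=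
  twistFactor N m₁ j₁ * twistFactor N m₂ j₂ * twistFactor N m₃ j₃ * Gam N j₁ j₂ j₃

/-- The normalised summand `S_{j₁,j₂,j₃} · (-1)^N {1} / {N+1}`. -/
noncomputable def normSummand (N m₁ m₂ m₃ j₁ j₂ j₃ : ℕ) : LaurentSeries ℚ :=
  summand N m₁ m₂ m₃ j₁ j₂ j₃ * ((-1) ^ N * curly 1 / curly (N + 1))

/-- `f` and `g` agree up to a sign and a power of `A`. -/
def EqUpToUnit (f g : LaurentSeries ℚ) : Prop :=
  ∃ (ε : ℤˣ) (s : ℤ), f = ((ε : ℤ) : LaurentSeries ℚ) * A ^ s * g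

/-- The `n` terms of highest degree in `q` of `f` and `g` have the same coefficients, up to a common
sign. The terms are counted from the leading one, zero coefficients included; one step in `q` is
four steps in `A`, so that the condition covers the first `4n` coefficients in `A`. -/
def HighestAgree (n : ℕ) (f g : LaurentSeries ℚ) : Prop :=
  ∃ ε : ℤˣ, ∀ k : ℕ, k < 4 * n →
    f.coeff (f.order + k) = ((ε : ℤ) : ℚ) * g.coeff (g.order + k)

end Pretzel

namespace Pretzel

open PowerSeries

/-! ### Partial products -/

theorem X_pow_dvd_Q_sub_Q {N M : ℕ} (h : N ≤ M) :
    (X : PowerSeries ℚ) ^ N ∣ Q M - Q N := by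
  rw [X_pow_dvd_iff]
  intro m hm
  rw [map_sub, coeff_Q_eq m M (by omega), coeff_Q_eq m N (by omega), sub_self]

theorem X_pow_dvd_Q_sub_Qinf (N : ℕ) : (X : PowerSeries ℚ) ^ N ∣ Q N - Qinf := by
  rw [X_pow_dvd_iff]
  intro m hm
  rw [map_sub, coeff_Q_eq m N (by omega), sub_self]

theorem constantCoeff_one_sub_X_pow {n : ℕ} (hn : n ≠ 0) :
    constantCoeff (1 - (X : PowerSeries ℚ) ^ n) = 1 := by
  simp [hn]

theorem constantCoeff_Q (M : ℕ) : constantCoeff (Q M) = 1 := by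
  rw [Q, map_prod]
  refine Finset.prod_eq_one fun k hk => constantCoeff_one_sub_X_pow ?_
  have := (Finset.mem_Icc.mp hk).1
  omega

/-- `(1 - u)(1 - u²)(1 - u³)`. -/
theorem Q_three :
    Q 3 = (1 - (X : PowerSeries ℚ)) * (1 - X ^ 2) * (1 - X ^ 3) := by
  simp [Q, Finset.prod_Icc_succ_top]

/-- The power series in `u = A⁴` that the normalised summand `S_{N-3,N,N}` equals up to a sign and a
power of `A`. -/
noncomputable def summandSeries (N : ℕ) : PowerSeries ℚ :=
  Q (3 * N - 2) * (1 - (X : PowerSeries ℚ) ^ (2 * N - 5)) * Q (N + 3) * Q N ^ 2 *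
    ((1 - (X : PowerSeries ℚ) ^ (N + 1)) * Q (2 * N) ^ 2 * Q (2 * N - 2) * Q 3)⁻¹

theorem summandSeries_mul (N : ℕ) :
    summandSeries N *
        ((1 - (X : PowerSeries ℚ) ^ (N + 1)) * Q (2 * N) ^ 2 * Q (2 * N - 2) * Q 3) =
      Q (3 * N - 2) * (1 - (X : PowerSeries ℚ) ^ (2 * N - 5)) * Q (N + 3) * Q N ^ 2 := by
  rw [summandSeries, mul_assoc, PowerSeries.inv_mul_cancel, mul_one]
  simp only [map_mul, map_pow, constantCoeff_Q, constantCoeff_one_sub_X_pow N.succ_ne_zero]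
  norm_num

theorem X_pow_dvd_summandSeries_sub {N : ℕ} (hN : 5 ≤ N) :
    (X : PowerSeries ℚ) ^ N ∣ summandSeries N - Q N * (Q 3)⁻¹ := by
  let I : Ideal (PowerSeries ℚ) := Ideal.span {X ^ N}
  let π := Ideal.Quotient.mk I
  have hX (k : ℕ) (hk : N ≤ k) : π (X ^ k) = 0 :=
    Ideal.Quotient.eq_zero_iff_mem.mpr (Ideal.mem_span_singleton.mpr (pow_dvd_pow X hk))
  have hQ (M : ℕ) (hM : N ≤ M) : π (Q M) = π (Q N) :=
    Ideal.Quotient.eq.mpr (Ideal.mem_span_singleton.mpr (X_pow_dvd_Q_sub_Q hM))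
  have unit (f : PowerSeries ℚ) (hf : constantCoeff f = 1) : π f * π f⁻¹ = 1 := by
    rw [← map_mul, PowerSeries.mul_inv_cancel _ (by rw [hf]; exact one_ne_zero), map_one]
  have h := congrArg π (summandSeries_mul N)
  simp only [map_mul, map_pow, map_sub, map_one] at h
  simp only [← map_pow π X] at h
  rw [hX (N + 1) (by omega), hX (2 * N - 5) (by omega), hQ (3 * N - 2) (by omega),
    hQ (N + 3) (by omega), hQ (2 * N) (by omega), hQ (2 * N - 2) (by omega)] at h
  have h3 := unit (Q 3) (constantCoeff_Q 3)
  have hN' := unit (Q N) (constantCoeff_Q N)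
  rw [← Ideal.mem_span_singleton, ← Ideal.Quotient.eq]
  change π _ = π _
  rw [map_mul]
  linear_combination (π (Q N)⁻¹ ^ 3 * π (Q 3)⁻¹) * h +
    (-π (summandSeries N) * π (Q N) ^ 3 * π (Q N)⁻¹ ^ 3) * h3 +
    (π (Q N) * π (Q 3)⁻¹ - π (summandSeries N)) *
      (1 + π (Q N) * π (Q N)⁻¹ + π (Q N) ^ 2 * π (Q N)⁻¹ ^ 2) * hN'

theorem constantCoeff_summandSeries (N : ℕ) (hN : 5 ≤ N) :
    constantCoeff (summandSeries N) = 1 := by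
  have h := congrArg constantCoeff (summandSeries_mul N)
  simpa only [map_mul, map_pow, constantCoeff_Q,
    constantCoeff_one_sub_X_pow N.succ_ne_zero,
    constantCoeff_one_sub_X_pow (show 2 * N - 5 ≠ 0 by omega), one_pow, mul_one] using h

/-! ### The variable `A` and the embedding `inA` -/

theorem A_ne_zero : A ≠ 0 := HahnSeries.single_ne_zero one_ne_zero

theorem A_zpow (s : ℤ) : A ^ s = HahnSeries.single s (1 : ℚ) := by
  rw [A, ← RatFunc.single_zpow]

theorem inA_mul (f g : PowerSeries ℚ) : inA (f * g) = inA f * inA g := by simp [inA]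

theorem inA_pow (f : PowerSeries ℚ) (n : ℕ) : inA (f ^ n) = inA f ^ n := by simp [inA]

theorem inA_one_sub_X_pow (n : ℕ) : inA (1 - X ^ n) = 1 - A ^ (4 * (n : ℤ)) := by
  rw [A_zpow]
  simp [inA, ← pow_mul]

theorem inA_coeff (f : PowerSeries ℚ) (k : ℕ) :
    (inA f).coeff k = if 4 ∣ k then coeff (k / 4) f else 0 := by
  rw [inA, HahnSeries.ofPowerSeries_apply_coeff, coeff_expand]

theorem inA_ne_zero {f : PowerSeries ℚ} (hf : constantCoeff f ≠ 0) : inA f ≠ 0 := by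
  intro h
  have := inA_coeff f 0
  simp [h] at this
  exact hf this.symm

theorem inA_order {f : PowerSeries ℚ} (hf : constantCoeff f ≠ 0) : (inA f).order = 0 := by
  refine le_antisymm (HahnSeries.order_le_of_coeff_ne_zero ?_)
    ((HahnSeries.le_order_iff_forall (inA_ne_zero hf)).mpr fun i hi => ?_)
  · have := inA_coeff f 0
    simp at this
    rwa [this]
  · exact (PowerSeries.coeff_coe (expand 4 (by norm_num) f) i).trans (if_pos hi)

/-! ### Equality up to a sign and a power of `A` -/

namespace EqUpToUnit

theorem refl (f : LaurentSeries ℚ) : EqUpToUnit f f := ⟨1, 0, by simp⟩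

theorem of_eq {f g : LaurentSeries ℚ} (h : f = g) : EqUpToUnit f g := h ▸ refl f

theorem mul {f g f' g' : LaurentSeries ℚ} (hf : EqUpToUnit f f') (hg : EqUpToUnit g g') :
    EqUpToUnit (f * g) (f' * g') := by
  obtain ⟨ε, s, rfl⟩ := hf
  obtain ⟨δ, t, rfl⟩ := hg
  refine ⟨ε * δ, s + t, ?_⟩
  rw [zpow_add₀ A_ne_zero]
  push_cast
  ring

theorem inv {f f' : LaurentSeries ℚ} (hf : EqUpToUnit f f') : EqUpToUnit f⁻¹ f'⁻¹ := by
  obtain ⟨ε, s, rfl⟩ := hf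
  refine ⟨ε, -s, ?_⟩
  rw [mul_inv, mul_inv, zpow_neg]
  rcases Int.units_eq_one_or ε with rfl | rfl <;> simp [inv_neg_one]

theorem div {f g f' g' : LaurentSeries ℚ} (hf : EqUpToUnit f f') (hg : EqUpToUnit g g') :
    EqUpToUnit (f / g) (f' / g') := by
  rw [div_eq_mul_inv, div_eq_mul_inv]
  exact hf.mul hg.inv

theorem trans {f g h : LaurentSeries ℚ} (hfg : EqUpToUnit f g) (hgh : EqUpToUnit g h) :
    EqUpToUnit f h := by
  obtain ⟨ε, s, rfl⟩ := hfg
  obtain ⟨δ, t, rfl⟩ := hgh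
  refine ⟨ε * δ, s + t, ?_⟩
  rw [zpow_add₀ A_ne_zero]
  push_cast
  ring

theorem pow {f f' : LaurentSeries ℚ} (hf : EqUpToUnit f f') (n : ℕ) :
    EqUpToUnit (f ^ n) (f' ^ n) := by
  induction n with
  | zero => simpa using refl 1
  | succ n ih => simpa only [pow_succ] using ih.mul hf

theorem prod {ι : Type*} {s : Finset ι} {f g : ι → LaurentSeries ℚ}
    (h : ∀ i, EqUpToUnit (f i) (g i)) : EqUpToUnit (∏ i ∈ s, f i) (∏ i ∈ s, g i) :=
  Finset.prod_hom_rel (refl 1) fun i _ _ hi => (h i).mul hi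

theorem neg_one_pow (n : ℕ) : EqUpToUnit ((-1) ^ n) 1 := ⟨(-1) ^ n, 0, by simp⟩

theorem A_zpow (s : ℤ) : EqUpToUnit (A ^ s) 1 := ⟨1, s, by simp⟩

end EqUpToUnit

theorem curly_eq (n : ℕ) :
    curly n = -A ^ (-(2 * (n : ℤ))) * inA (1 - X ^ n) := by
  rw [inA_one_sub_X_pow, curly, mul_sub, mul_one, neg_mul, ← zpow_add₀ A_ne_zero]
  ring_nf

theorem curly_eqUpToUnit (n : ℕ) : EqUpToUnit (curly n) (inA (1 - X ^ n)) :=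
  ⟨-1, -(2 * (n : ℤ)), by rw [curly_eq]; simp⟩

theorem curly_ne_zero {n : ℕ} (hn : n ≠ 0) : curly n ≠ 0 := by
  rw [curly_eq]
  refine mul_ne_zero (neg_ne_zero.mpr (zpow_ne_zero _ A_ne_zero)) (inA_ne_zero ?_)
  rw [constantCoeff_one_sub_X_pow hn]
  exact one_ne_zero

theorem inA_Q (M : ℕ) : inA (Q M) = ∏ k ∈ Finset.Icc 1 M, inA (1 - X ^ k) := by
  simp only [inA, Q, map_prod]

theorem curlyFact_eqUpToUnit (n : ℕ) : EqUpToUnit (curlyFact n) (inA (Q n)) := by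
  rw [inA_Q, curlyFact]
  exact EqUpToUnit.prod fun k => curly_eqUpToUnit k

/-! ### Quantum factorials and networks -/

theorem bracket_ne_zero {n : ℕ} (hn : n ≠ 0) : bracket n ≠ 0 :=
  div_ne_zero (curly_ne_zero hn) (curly_ne_zero one_ne_zero)

theorem bracketFact_ne_zero (n : ℕ) : bracketFact n ≠ 0 :=
  Finset.prod_ne_zero_iff.mpr fun k hk => bracket_ne_zero (by
    have := (Finset.mem_Icc.mp hk).1
    omega)

theorem curlyFact_ne_zero (n : ℕ) : curlyFact n ≠ 0 :=
  Finset.prod_ne_zero_iff.mpr fun k hk => curly_ne_zero (by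
    have := (Finset.mem_Icc.mp hk).1
    omega)

theorem bracketFact_zero : bracketFact 0 = 1 := by simp [bracketFact]

theorem bracketFact_succ (n : ℕ) : bracketFact (n + 1) = bracketFact n * bracket (n + 1) := by
  rw [bracketFact, Finset.prod_Icc_succ_top (by omega), ← bracketFact]

theorem bracketFact_eq_curlyFact_div (n : ℕ) :
    bracketFact n = curlyFact n / curly 1 ^ n := by
  simp [bracketFact, curlyFact, bracket, Finset.prod_div_distrib]

theorem thetaInt_eqUpToUnit (i j k : ℕ) :
    EqUpToUnit (thetaInt i j k)
      (bracketFact (i + j + k + 1) * bracketFact i * bracketFact j * bracketFact k /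
        (bracketFact (i + j) * bracketFact (j + k) * bracketFact (i + k))) := by
  simpa only [one_mul, thetaInt, mul_div_assoc] using
    (EqUpToUnit.neg_one_pow (i + j + k)).mul (.refl
      (bracketFact (i + j + k + 1) * bracketFact i * bracketFact j * bracketFact k /
        (bracketFact (i + j) * bracketFact (j + k) * bracketFact (i + k))))

theorem gamma_eqUpToUnit_one (a b c : ℕ) : EqUpToUnit (gamma a b c) 1 := by
  simpa only [one_mul, gamma] using (EqUpToUnit.neg_one_pow _).mul (EqUpToUnit.A_zpow _)

theorem twistFactor_eqUpToUnit (k j m : ℕ) :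
    EqUpToUnit (twistFactor (j + k) m j)
      (bracket (2 * j + 1) * bracketFact (2 * j) * bracketFact (j + k) ^ 2 /
        (bracketFact (2 * j + k + 1) * bracketFact j ^ 2 * bracketFact k)) := by
  have hθ : theta (j + k) (j + k) (2 * j) = thetaInt j j k := by
    rw [theta]
    congr 1 <;> omega
  have hγ : EqUpToUnit (gamma (j + k) (j + k) (2 * j) ^ m) 1 := by
    simpa only [one_pow] using (gamma_eqUpToUnit_one _ _ _).pow m
  have hΔ : EqUpToUnit (Delta (2 * j)) (bracket (2 * j + 1)) := by
    simpa only [one_mul, Delta] using (EqUpToUnit.neg_one_pow (2 * j)).mul (.refl (bracket (2 * j + 1)))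
  rw [twistFactor, hθ]
  refine (hγ.mul (hΔ.div (thetaInt_eqUpToUnit j j k))).trans (.of_eq ?_)
  rw [← two_mul]
  have := bracketFact_ne_zero
  field_simp

theorem twistFactor_self_eqUpToUnit_one (N m : ℕ) : EqUpToUnit (twistFactor N m N) 1 := by
  refine (twistFactor_eqUpToUnit 0 N m).trans (.of_eq ?_)
  have h₁ := bracketFact_ne_zero N
  have h₂ := bracketFact_ne_zero (2 * N)
  have h₃ := bracket_ne_zero (2 * N).succ_ne_zero
  simp only [add_zero, bracketFact_succ, bracketFact_zero, mul_one]
  field_simp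

theorem tet_eqUpToUnit (n : ℕ) :
    EqUpToUnit (tet (n + 3) n (n + 3) (n + 3))
      (bracketFact (n + 6) * bracketFact n ^ 2 * bracketFact (3 * n + 7) /
        (bracketFact (2 * n) * bracketFact (2 * n + 6) ^ 2)) := by
  have h : tet (n + 3) n (n + 3) (n + 3) = (-1) ^ (3 * n + 6) *
      (bracketFact (n + 6) * bracketFact n ^ 2 * bracketFact (3 * n + 7) /
        (bracketFact (2 * n) * bracketFact (2 * n + 6) ^ 2)) := by
    have a₀ : n + 3 + n = 2 * n + 3 := by omega
    have a₁ : n + 3 + (n + 3) = 2 * n + 6 := by omega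
    have a₃ : n + (n + 3) + (n + 3) = 3 * n + 6 := by omega
    have b₀ : 2 * n + 6 + (n + 3) = 3 * n + 9 := by omega
    have b₁ : 2 * n + 3 + (n + 3) = 3 * n + 6 := by omega
    have hmax : max (max (2 * n + 3) (2 * n + 6)) (max (2 * n + 6) (3 * n + 6)) = 3 * n + 6 := by
      omega
    have hmin : min (min (3 * n + 9) (3 * n + 6)) (3 * n + 6) = 3 * n + 6 := by omega
    have d₀₀ : 3 * n + 9 - (2 * n + 3) = n + 6 := by omega
    have d₀₁ : 3 * n + 9 - (2 * n + 6) = n + 3 := by omega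
    have d₀₃ : 3 * n + 9 - (3 * n + 6) = 3 := by omega
    have d₁₀ : 3 * n + 6 - (2 * n + 3) = n + 3 := by omega
    have d₁₁ : 3 * n + 6 - (2 * n + 6) = n := by omega
    have h₂ : 2 * (n + 3) = 2 * n + 6 := by omega
    have := bracketFact_ne_zero n
    have := bracketFact_ne_zero 3
    have := bracketFact_ne_zero (n + 3)
    have := bracketFact_ne_zero (2 * n)
    have := bracketFact_ne_zero (2 * n + 6)
    simp only [tet, Fin.prod_univ_four, Fin.prod_univ_three, Matrix.cons_val, a₀, a₁, a₃, b₀, b₁,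
      hmax, hmin, Finset.Icc_self, Finset.sum_singleton, d₀₀, d₀₁, d₀₃, d₁₀, d₁₁, h₂,
      Nat.sub_self, bracketFact_zero]
    field_simp
  rw [h]
  simpa only [one_mul] using (EqUpToUnit.neg_one_pow (3 * n + 6)).mul (.refl _)

theorem Gam_eqUpToUnit (n : ℕ) :
    EqUpToUnit (Gam (n + 3) n (n + 3) (n + 3))
      (bracketFact (n + 6) * bracketFact n ^ 2 * bracketFact (3 * n + 7) /
        (bracketFact (2 * n) * bracketFact (2 * n + 6) ^ 2)) := by
  have hθ : theta (2 * n) (2 * (n + 3)) (2 * (n + 3)) = thetaInt (n + 6) n n := by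
    rw [theta]
    congr 1 <;> omega
  rw [Gam, hθ]
  refine (((tet_eqUpToUnit n).pow 2).div (thetaInt_eqUpToUnit (n + 6) n n)).trans (.of_eq ?_)
  rw [show n + 6 + n + n + 1 = 3 * n + 7 by ring, show n + 6 + n = 2 * n + 6 by ring, ← two_mul]
  have := bracketFact_ne_zero
  field_simp

theorem normSummand_eqUpToUnit (N m₁ m₂ m₃ : ℕ) (hN : 3 ≤ N) :
    EqUpToUnit (normSummand N m₁ m₂ m₃ (N - 3) N N)
      (curlyFact (3 * N - 2) * curly (2 * N - 5) * curlyFact (N + 3) * curlyFact N ^ 2 /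
        (curly (N + 1) * curlyFact (2 * N) ^ 2 * curlyFact (2 * N - 2) * curlyFact 3)) := by
  obtain ⟨n, rfl⟩ := Nat.exists_eq_add_of_le' hN
  have hnorm : EqUpToUnit ((-1) ^ (n + 3) * curly 1 / curly (n + 3 + 1))
      (curly 1 / curly (n + 3 + 1)) := by
    simpa only [one_mul, mul_div_assoc] using
      (EqUpToUnit.neg_one_pow (n + 3)).mul (.refl (curly 1 / curly (n + 3 + 1)))
  rw [normSummand, summand, Nat.add_sub_cancel]
  refine (((((twistFactor_eqUpToUnit 3 n m₁).mul (twistFactor_self_eqUpToUnit_one _ m₂)).mul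
    (twistFactor_self_eqUpToUnit_one _ m₃)).mul (Gam_eqUpToUnit n)).mul hnorm).trans (.of_eq ?_)
  rw [show 3 * (n + 3) - 2 = 3 * n + 7 by omega, show 2 * (n + 3) - 5 = 2 * n + 1 by omega,
    show 2 * (n + 3) = 2 * n + 6 by omega, show 2 * n + 6 - 2 = 2 * n + 4 by omega,
    show 2 * n + 3 + 1 = 2 * n + 4 by omega, show n + 3 + 3 = n + 6 by omega,
    show n + 3 + 1 = n + 4 by omega]
  simp only [bracketFact_eq_curlyFact_div, bracket]
  have h₀ : curly 1 ≠ 0 := curly_ne_zero one_ne_zero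
  have h₁ : curly (n + 4) ≠ 0 := curly_ne_zero (by omega)
  have := curlyFact_ne_zero (2 * n)
  have := curlyFact_ne_zero n
  have := curlyFact_ne_zero (2 * n + 4)
  have := curlyFact_ne_zero 3
  have := curlyFact_ne_zero (2 * n + 6)
  field_simp
  ring

/-! ### Leading coefficients -/

theorem HighestAgree.of_eqUpToUnit_inA {n : ℕ} {f : LaurentSeries ℚ} {F G : PowerSeries ℚ}
    (hf : EqUpToUnit f (inA F)) (hF : constantCoeff F ≠ 0) (hG : constantCoeff G ≠ 0) (δ : ℤˣ)
    (h : ∀ k < n, coeff k F = ((δ : ℤ) : ℚ) * coeff k G) : HighestAgree n f (inA G) := by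
  obtain ⟨ε, s, rfl⟩ := hf
  have hε : (((ε : ℤ) : ℚ)) ≠ 0 := by simp
  have hA : ((ε : ℤ) : LaurentSeries ℚ) * A ^ s = HahnSeries.single s ((ε : ℤ) : ℚ) := by
    rcases Int.units_eq_one_or ε with rfl | rfl <;> simp [A_zpow]
  have hs : HahnSeries.single s ((ε : ℤ) : ℚ) ≠ 0 := HahnSeries.single_ne_zero hε
  refine ⟨ε * δ, fun k hk => ?_⟩
  rw [hA, HahnSeries.order_mul hs (inA_ne_zero hF), HahnSeries.order_single hε, inA_order hF,
    inA_order hG, add_zero, zero_add, add_comm s, HahnSeries.coeff_single_mul_add, inA_coeff,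
    inA_coeff]
  split_ifs
  · rw [h _ (by omega)]
    push_cast
    ring
  · simp

theorem summandQuotient_eqUpToUnit (N : ℕ) :
    EqUpToUnit
      (curlyFact (3 * N - 2) * curly (2 * N - 5) * curlyFact (N + 3) * curlyFact N ^ 2 /
        (curly (N + 1) * curlyFact (2 * N) ^ 2 * curlyFact (2 * N - 2) * curlyFact 3))
      (inA (summandSeries N)) := by
  refine ((((curlyFact_eqUpToUnit _).mul (curly_eqUpToUnit _)).mul
    (curlyFact_eqUpToUnit _)).mul ((curlyFact_eqUpToUnit _).pow 2)).div
      ((((curly_eqUpToUnit _).mul ((curlyFact_eqUpToUnit _).pow 2)).mul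
        (curlyFact_eqUpToUnit _)).mul (curlyFact_eqUpToUnit _)) |>.trans (.of_eq ?_)
  simp only [← inA_mul, ← inA_pow]
  rw [← summandSeries_mul, inA_mul, mul_div_cancel_right₀]
  apply inA_ne_zero
  simp only [map_mul, map_pow, constantCoeff_Q, constantCoeff_one_sub_X_pow N.succ_ne_zero]
  norm_num

theorem highestAgree_normSummand (N m₁ m₂ m₃ : ℕ) (hN : 5 ≤ N) :
    HighestAgree N (normSummand N m₁ m₂ m₃ (N - 3) N N) (inA (-Qinf * (Q 3)⁻¹)) := by
  refine .of_eqUpToUnit_inA ((normSummand_eqUpToUnit N m₁ m₂ m₃ (by omega)).trans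
    (summandQuotient_eqUpToUnit N)) (by simp [constantCoeff_summandSeries N hN])
    ?_ (-1) ?_
  · have h0 : constantCoeff Qinf = 1 := by
      rw [← coeff_zero_eq_constantCoeff_apply, ← coeff_Q_eq 0 0 le_rfl,
        coeff_zero_eq_constantCoeff_apply, constantCoeff_Q]
    simp [h0, constantCoeff_Q]
  · have h : (X : PowerSeries ℚ) ^ N ∣ summandSeries N - Qinf * (Q 3)⁻¹ := by
      have := (X_pow_dvd_summandSeries_sub hN).add
        ((X_pow_dvd_Q_sub_Qinf N).mul_right (Q 3)⁻¹)
      rwa [sub_mul, sub_add_sub_cancel] at this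
    intro k hk
    have := X_pow_dvd_iff.mp h k hk
    rw [map_sub, sub_eq_zero] at this
    simpa using this

end Pretzel

theorem summand_N_minus_three_congr (N : ℕ) (hN : 5 ≤ N) :
    ((PowerSeries.X : PowerSeries ℚ) ^ N ∣
      Pretzel.Q (3 * N - 2) * (1 - (PowerSeries.X : PowerSeries ℚ) ^ (2 * N - 5)) *
          Pretzel.Q (N + 3) * Pretzel.Q N ^ 2 *
          ((1 - (PowerSeries.X : PowerSeries ℚ) ^ (N + 1)) * Pretzel.Q (2 * N) ^ 2 *
            Pretzel.Q (2 * N - 2) *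
            ((1 - (PowerSeries.X : PowerSeries ℚ)) * (1 - PowerSeries.X ^ 2) *
              (1 - PowerSeries.X ^ 3)))⁻¹ -
        Pretzel.Q N *
          ((1 - (PowerSeries.X : PowerSeries ℚ)) * (1 - PowerSeries.X ^ 2) *
            (1 - PowerSeries.X ^ 3))⁻¹) ∧
    ∀ m₁ m₂ m₃ : ℕ,
      Pretzel.EqUpToUnit (Pretzel.normSummand N m₁ m₂ m₃ (N - 3) N N)
        (Pretzel.curlyFact (3 * N - 2) * Pretzel.curly (2 * N - 5) * Pretzel.curlyFact (N + 3) *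
            Pretzel.curlyFact N ^ 2 /
          (Pretzel.curly (N + 1) * Pretzel.curlyFact (2 * N) ^ 2 *
            Pretzel.curlyFact (2 * N - 2) * Pretzel.curlyFact 3)) ∧
      Pretzel.HighestAgree N (Pretzel.normSummand N m₁ m₂ m₃ (N - 3) N N)
        (Pretzel.inA
          (-Pretzel.Qinf *
            ((1 - (PowerSeries.X : PowerSeries ℚ) ^ 3) * (1 - PowerSeries.X ^ 2) *
              (1 - PowerSeries.X))⁻¹)) := by
  have hQ := Pretzel.Q_three
  refine ⟨?_, fun m₁ m₂ m₃ =>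
    ⟨Pretzel.normSummand_eqUpToUnit N m₁ m₂ m₃ (by omega), ?_⟩⟩
  · rw [← hQ]
    exact Pretzel.X_pow_dvd_summandSeries_sub hN
  · rw [show (1 - (PowerSeries.X : PowerSeries ℚ) ^ 3) * (1 - PowerSeries.X ^ 2) *
        (1 - PowerSeries.X) = Pretzel.Q 3 by rw [hQ]; ring]
    exact Pretzel.highestAgree_normSummand N m₁ m₂ m₃ hN
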